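/- For every ε > 0 there is a constant C (depending only on k, r, h_1,…,h_r, ε) such that for all t ≥ 1 and all q, a ∈ ℕ: | #{n ≤ t : n ∈ ℛ, n ≡ a (mod q)} − η(q,a)·t | ≤ C·t^{2/(k+1)+ε}. -/

import Mathlib

open scoped BigOperators Classical

noncomputable section

/-- `n` is `k`-free: no `k`-th power of a prime divides `n`. -/
def KFree (k n : ℕ) : Prop := ∀ p : ℕ, p.Prime → ¬ p ^ k ∣ n

/-- The density `η(q,a)` of the `k`-free `r`-tuples (with shifts `h`) in the residue class
`a mod q`. -/
def eta (k r : ℕ) (h : Fin r → ℕ) (q a : ℕ) : ℝ :=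
  ∑' d : Fin r → ℕ,
    if (∀ i, 1 ≤ d i) ∧
        (∀ i j, ((Nat.gcd (d i ^ k) (d j ^ k) : ℤ) ∣ (h i : ℤ) - (h j : ℤ))) ∧
        (∀ i, Nat.gcd q (d i ^ k) ∣ a + h i)
    then (∏ i, (ArithmeticFunction.moebius (d i) : ℝ)) /
          ((Nat.lcm q (Finset.univ.lcm fun i => d i ^ k) : ℕ) : ℝ)
    else 0

/-- The number of `n ≤ x` with `n ∈ ℛ` (i.e. all `n + h i` are `k`-free) and
`n ≡ a (mod q)`. -/
def countR (k r : ℕ) (h : Fin r → ℕ) (x : ℝ) (q a : ℕ) : ℕ :=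
  ((Finset.Icc 1 ⌊x⌋₊).filter fun n => (∀ i, KFree k (n + h i)) ∧ n % q = a % q).card

/-- The error term `E_x(q,a)`. -/
def Ex (k r : ℕ) (h : Fin r → ℕ) (x : ℝ) (q a : ℕ) : ℝ :=
  (countR k r h x q a : ℝ) - eta k r h q a * x

/-- `R_p`: the number of distinct residues of `h_1, …, h_r` modulo `p^k`. -/
def Rp (k r : ℕ) (h : Fin r → ℕ) (p : ℕ) : ℕ :=
  ((Finset.univ : Finset (Fin r)).image fun i => h i % p ^ k).card

theorem Nat.gcd_lcm_dvd_lcm_gcd (a b m : ℕ) :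
    Nat.gcd (Nat.lcm a b) m ∣ Nat.lcm (Nat.gcd a m) (Nat.gcd b m) := by
  rcases Nat.eq_zero_or_pos a with rfl | ha
  · simp [Nat.dvd_lcm_left]
  rcases Nat.eq_zero_or_pos b with rfl | hb
  · simp [Nat.dvd_lcm_right]
  rcases Nat.eq_zero_or_pos m with rfl | hm
  · simp
  have hga : Nat.gcd a m ≠ 0 := (Nat.gcd_pos_of_pos_right _ hm).ne'
  have hgb : Nat.gcd b m ≠ 0 := (Nat.gcd_pos_of_pos_right _ hm).ne'
  rw [← Nat.factorization_le_iff_dvd (Nat.gcd_pos_of_pos_right _ hm).ne' (Nat.lcm_ne_zero hga hgb),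
    Nat.factorization_lcm hga hgb, Nat.factorization_gcd (Nat.lcm_ne_zero ha.ne' hb.ne') hm.ne',
    Nat.factorization_lcm ha.ne' hb.ne', Nat.factorization_gcd ha.ne' hm.ne',
    Nat.factorization_gcd hb.ne' hm.ne', ]
  intro p
  simp only [Finsupp.inf_apply, Finsupp.sup_apply]
  exact inf_sup_right _ _ _ |>.le

theorem gcd_finset_lcm_dvd {ι : Type*} (s : Finset ι) (m : ι → ℕ) (M : ℕ) (z : ℤ)
    (hz : ∀ i ∈ s, (Nat.gcd (m i) M : ℤ) ∣ z) : (Nat.gcd (s.lcm m) M : ℤ) ∣ z := by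
  classical
  induction s using Finset.induction_on with
  | empty => simp
  | insert i s hi ih =>
    rw [Finset.lcm_insert]
    have h1 := ih fun j hj => hz j (Finset.mem_insert_of_mem hj)
    have h2 := hz i (Finset.mem_insert_self _ _)
    rw [Int.natCast_dvd] at h1 h2 ⊢
    exact (Nat.gcd_lcm_dvd_lcm_gcd _ _ _).trans (Nat.lcm_dvd h2 h1)

/-- Chinese remainder theorem for pairwise compatible congruences. -/
theorem exists_int_forall_dvd_sub {ι : Type*} (s : Finset ι) (m : ι → ℕ) (c : ι → ℤ)
    (hc : ∀ i ∈ s, ∀ j ∈ s, (Nat.gcd (m i) (m j) : ℤ) ∣ c i - c j) :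
    ∃ x : ℤ, ∀ i ∈ s, (m i : ℤ) ∣ x - c i := by
  classical
  induction s using Finset.induction_on with
  | empty => simp
  | insert i s hi ih =>
    obtain ⟨x, hx⟩ := ih fun a ha b hb =>
      hc a (Finset.mem_insert_of_mem ha) b (Finset.mem_insert_of_mem hb)
    have hg : (Nat.gcd (s.lcm m) (m i) : ℤ) ∣ x - c i := by
      refine gcd_finset_lcm_dvd s m (m i) _ fun j hj => ?_
      have h1 : (Nat.gcd (m j) (m i) : ℤ) ∣ x - c j :=
        (Int.natCast_dvd_natCast.2 (Nat.gcd_dvd_left _ _)).trans (hx j hj)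
      have h2 := hc j (Finset.mem_insert_of_mem hj) i (Finset.mem_insert_self _ _)
      simpa using dvd_add h1 h2
    obtain ⟨w, hw⟩ := hg
    rw [Nat.gcd_eq_gcd_ab] at hw
    refine ⟨x - (s.lcm m : ℕ) * (Nat.gcdA (s.lcm m) (m i) * w), fun j hj => ?_⟩
    rcases Finset.mem_insert.1 hj with rfl | hj
    · exact ⟨Nat.gcdB (s.lcm m) (m j) * w, by linear_combination hw⟩
    · have h1 : (m j : ℤ) ∣ (s.lcm m : ℕ) := Int.natCast_dvd_natCast.2 (Finset.dvd_lcm hj)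
      have := dvd_sub (hx j hj) (h1.mul_right (Nat.gcdA (s.lcm m) (m i) * w))
      rwa [sub_right_comm] at this

theorem abs_card_modEq_sub_le (L v : ℕ) (hL : 0 < L) (t : ℝ) (ht : 0 ≤ t) :
    |((((Finset.Icc 1 ⌊t⌋₊).filter fun n => n ≡ v [MOD L]).card : ℕ) : ℝ) - t / L| ≤ 2 := by
  have h0 : Finset.Icc 1 ⌊t⌋₊ = Finset.Ioc 0 ⌊t⌋₊ := rfl
  have h1 := Nat.Ioc_filter_modEq_card 0 ⌊t⌋₊ hL v
  rw [h0]
  set N := ((Finset.Ioc 0 ⌊t⌋₊).filter fun n => n ≡ v [MOD L]).card with hN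
  have hLr : (1 : ℝ) ≤ L := by exact_mod_cast hL
  have hLq : (0 : ℚ) < L := by exact_mod_cast hL
  set A : ℚ := ((⌊t⌋₊ : ℚ) - v) / L with hA
  set B : ℚ := (((0 : ℕ) : ℚ) - v) / L with hB
  have hAB : A - B = (⌊t⌋₊ : ℚ) / L := by rw [hA, hB]; push_cast; field_simp; ring
  have hle : ⌊B⌋ ≤ ⌊A⌋ := by
    apply Int.floor_le_floor
    have : (0 : ℚ) ≤ (⌊t⌋₊ : ℚ) / L := by positivity
    linarith
  rw [max_eq_left (by linarith)] at h1
  have hq : |(N : ℚ) - (⌊t⌋₊ : ℚ) / L| ≤ 1 := by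
    have : (N : ℚ) = (⌊A⌋ : ℚ) - ⌊B⌋ := by exact_mod_cast h1
    rw [this, ← hAB, abs_le]
    have a1 := Int.floor_le A
    have a2 := Int.lt_floor_add_one A
    have a3 := Int.floor_le B
    have a4 := Int.lt_floor_add_one B
    constructor <;> linarith
  have hr : |(N : ℝ) - (⌊t⌋₊ : ℝ) / L| ≤ 1 := by
    have := (Rat.cast_le (K := ℝ)).2 hq
    push_cast at this
    exact this
  have h2 : |(⌊t⌋₊ : ℝ) / L - t / L| ≤ 1 := by
    rw [← sub_div, abs_div, abs_of_nonneg (by linarith : (0 : ℝ) ≤ L), div_le_one (by linarith)]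
    have b1 := Nat.floor_le ht
    have b2 := Nat.lt_floor_add_one t
    rw [abs_le]
    constructor <;> linarith
  calc |(N : ℝ) - t / L| ≤ |(N : ℝ) - (⌊t⌋₊ : ℝ) / L| + |(⌊t⌋₊ : ℝ) / L - t / L| :=
        abs_sub_le _ _ _
    _ ≤ 2 := by linarith

theorem prod_le_lcm_mul_pow {ι : Type*} (s : Finset ι) (m : ι → ℕ) (H n : ℕ) (hH0 : 1 ≤ H)
    (hs : s.card ≤ n) (hm : ∀ i ∈ s, 0 < m i)
    (hH : ∀ i ∈ s, ∀ j ∈ s, i ≠ j → Nat.gcd (m i) (m j) ≤ H) :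
    ∏ i ∈ s, m i ≤ s.lcm m * (H ^ n) ^ s.card := by
  classical
  induction s using Finset.induction_on with
  | empty => simp
  | insert i s hi ih =>
    rw [Finset.card_insert_of_notMem hi] at hs
    have ih' := ih (by lia) (fun j hj => hm j (Finset.mem_insert_of_mem hj)) fun a ha b hb =>
      hH a (Finset.mem_insert_of_mem ha) b (Finset.mem_insert_of_mem hb)
    have hmi := hm i (Finset.mem_insert_self _ _)
    rw [Finset.prod_insert hi, Finset.lcm_insert, Finset.card_insert_of_notMem hi]
    have hdvd : (Nat.gcd (s.lcm m) (m i) : ℤ) ∣ ((∏ j ∈ s, Nat.gcd (m j) (m i) : ℕ) : ℤ) :=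
      gcd_finset_lcm_dvd s m (m i) _ fun j hj =>
        Int.natCast_dvd_natCast.2 (Finset.dvd_prod_of_mem (fun j => Nat.gcd (m j) (m i)) hj)
    have hg : Nat.gcd (m i) (s.lcm m) ≤ H ^ n := by
      rw [Nat.gcd_comm]
      calc _ ≤ ∏ j ∈ s, Nat.gcd (m j) (m i) :=
            Nat.le_of_dvd (Finset.prod_pos fun j _ => Nat.gcd_pos_of_pos_right _ hmi)
              (Int.natCast_dvd_natCast.1 hdvd)
        _ ≤ H ^ s.card := Finset.prod_le_pow_card _ _ _ fun j hj =>
            hH j (Finset.mem_insert_of_mem hj) i (Finset.mem_insert_self _ _)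
              (by rintro rfl; exact hi hj)
        _ ≤ H ^ n := Nat.pow_le_pow_right hH0 (by lia)
    calc m i * ∏ j ∈ s, m j ≤ m i * (s.lcm m * (H ^ n) ^ s.card) := Nat.mul_le_mul_left _ ih'
      _ = Nat.gcd (m i) (s.lcm m) * Nat.lcm (m i) (s.lcm m) * (H ^ n) ^ s.card := by
          rw [Nat.gcd_mul_lcm, mul_assoc]
      _ ≤ H ^ n * Nat.lcm (m i) (s.lcm m) * (H ^ n) ^ s.card := by gcongr
      _ = Nat.lcm (m i) (s.lcm m) * (H ^ n) ^ (s.card + 1) := by ring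

/-- The number of squarefree divisors of `b` is `O(b^δ)`. -/
theorem exists_card_squarefree_divisors_le (δ : ℝ) (hδ : 0 < δ) :
    ∃ C : ℝ, 1 ≤ C ∧ ∀ b : ℕ, 1 ≤ b →
      (((b.divisors.filter Squarefree).card : ℕ) : ℝ) ≤ C * (b : ℝ) ^ δ := by
  obtain ⟨P, hP⟩ := exists_nat_ge ((2 : ℝ) ^ (1 / δ))
  refine ⟨2 ^ P, one_le_pow₀ one_le_two, fun b hb => ?_⟩
  have hcard : (b.divisors.filter Squarefree).card ≤ 2 ^ b.primeFactors.card := by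
    rw [← Finset.card_powerset]
    refine Finset.card_le_card_of_injOn Nat.primeFactors (fun d hd => ?_) fun d hd e he hde => ?_
    · simp only [Finset.coe_filter, Nat.mem_divisors, Set.mem_ofPred_eq] at hd
      simpa using Nat.primeFactors_mono hd.1.1 hd.1.2
    · simp only [Finset.coe_filter, Set.mem_ofPred_eq] at hd he
      rw [← Nat.prod_primeFactors_of_squarefree hd.2, ← Nat.prod_primeFactors_of_squarefree he.2,
        hde]
  have hterm : ∀ p ∈ b.primeFactors,
      (2 : ℝ) ≤ (if p ∈ Finset.range P then 2 else 1) * (p : ℝ) ^ δ := by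
    intro p hp
    have hp1 : (1 : ℝ) ≤ p := by exact_mod_cast (Nat.prime_of_mem_primeFactors hp).one_le
    split_ifs with hpP
    · nlinarith [Real.one_le_rpow hp1 hδ.le]
    · have hpP' : (P : ℝ) ≤ p := by
        rw [Finset.mem_range, not_lt] at hpP
        exact_mod_cast hpP
      calc (2 : ℝ) = ((2 : ℝ) ^ (1 / δ)) ^ δ := by
            rw [← Real.rpow_mul (by norm_num), one_div_mul_cancel hδ.ne', Real.rpow_one]
        _ ≤ (p : ℝ) ^ δ := by gcongr; linarith
        _ = 1 * (p : ℝ) ^ δ := (one_mul _).symm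
  have hprod : (∏ p ∈ b.primeFactors, p : ℕ) ≤ b :=
    Nat.le_of_dvd hb (Nat.prod_primeFactors_dvd b)
  calc (((b.divisors.filter Squarefree).card : ℕ) : ℝ) ≤ ∏ _p ∈ b.primeFactors, (2 : ℝ) := by
        rw [Finset.prod_const]; exact_mod_cast hcard
    _ ≤ ∏ p ∈ b.primeFactors, ((if p ∈ Finset.range P then 2 else 1) * (p : ℝ) ^ δ) :=
        Finset.prod_le_prod (fun _ _ => by norm_num) hterm
    _ = 2 ^ (b.primeFactors.filter (· ∈ Finset.range P)).card *
          ((∏ p ∈ b.primeFactors, p : ℕ) : ℝ) ^ δ := by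
        rw [Finset.prod_mul_distrib, Real.finsetProd_rpow _ _ fun _ _ => Nat.cast_nonneg _,
          Nat.cast_prod, Finset.prod_ite]
        simp
    _ ≤ 2 ^ P * (b : ℝ) ^ δ := by
        gcongr
        · norm_num
        · calc _ ≤ (Finset.range P).card := Finset.card_le_card fun p hp =>
                (Finset.mem_filter.1 hp).2
            _ = P := Finset.card_range P

theorem kFree_iff_floorRoot {k n : ℕ} :
    KFree k n ↔ Nat.floorRoot k n = 1 := by
  rw [Nat.eq_one_iff_not_exists_prime_dvd]
  simp only [KFree, Nat.pow_dvd_iff_dvd_floorRoot]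

theorem sum_moebius_squarefree_floorRoot {k n : ℕ} :
    ∑ d ∈ (Nat.floorRoot k n).divisors.filter Squarefree, (ArithmeticFunction.moebius d : ℝ) =
      if KFree k n then 1 else 0 := by
  have h1 : ∑ d ∈ (Nat.floorRoot k n).divisors, ArithmeticFunction.moebius d =
      if Nat.floorRoot k n = 1 then 1 else 0 := by
    rw [← ArithmeticFunction.coe_mul_zeta_apply, ArithmeticFunction.moebius_mul_coe_zeta,
      ArithmeticFunction.one_apply]
  rw [Finset.sum_filter_of_ne fun d _ hd => ArithmeticFunction.moebius_ne_zero_iff_squarefree.1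
    (by exact_mod_cast hd), ← Int.cast_sum, h1]
  simp only [kFree_iff_floorRoot]
  split_ifs <;> simp

/-- The squarefree tuples `d` with `d i ^ k ∣ n + h i` for all `i`. -/
def sqfTuples (k r : ℕ) (h : Fin r → ℕ) (n : ℕ) : Finset (Fin r → ℕ) :=
  Fintype.piFinset fun i => (Nat.floorRoot k (n + h i)).divisors.filter Squarefree

theorem mem_sqfTuples {k r n : ℕ} {h : Fin r → ℕ} (hk : k ≠ 0) (hn : n ≠ 0) {d : Fin r → ℕ} :
    d ∈ sqfTuples k r h n ↔ ∀ i, d i ^ k ∣ n + h i ∧ Squarefree (d i) := by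
  simp only [sqfTuples, Fintype.mem_piFinset, Finset.mem_filter, Nat.mem_divisors,
    Nat.pow_dvd_iff_dvd_floorRoot]
  refine forall_congr' fun i => ?_
  have : Nat.floorRoot k (n + h i) ≠ 0 := Nat.floorRoot_ne_zero.2 ⟨hk, by lia⟩
  tauto

theorem sum_sqfTuples_moebius {k r n : ℕ} {h : Fin r → ℕ} :
    ∑ d ∈ sqfTuples k r h n, ∏ i, (ArithmeticFunction.moebius (d i) : ℝ) =
      if ∀ i, KFree k (n + h i) then 1 else 0 := by
  rw [sqfTuples, ← Finset.prod_univ_sum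
      (fun i => (Nat.floorRoot k (n + h i)).divisors.filter Squarefree)
      fun _ d => (ArithmeticFunction.moebius d : ℝ),
    Finset.prod_congr rfl fun i _ => sum_moebius_squarefree_floorRoot,
    Finset.prod_ite_zero]
  simp

theorem exists_card_sqfTuples_le (k r : ℕ) (hk : k ≠ 0) (h : Fin r → ℕ) (M : ℕ) (hM1 : 1 ≤ M)
    (hM : ∀ i, 1 + h i ≤ M) (δ : ℝ) (hδ : 0 < δ) :
    ∃ C : ℝ, 0 ≤ C ∧ ∀ t : ℝ, 1 ≤ t → ∀ n : ℕ, 1 ≤ n → (n : ℝ) ≤ t →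
      (((sqfTuples k r h n).card : ℕ) : ℝ) ≤ C * t ^ δ := by
  obtain ⟨C, hC1, hC⟩ := exists_card_squarefree_divisors_le (δ / (r + 1)) (by positivity)
  refine ⟨(C * (M : ℝ) ^ (δ / (r + 1))) ^ r, by positivity, fun t ht n hn hnt => ?_⟩
  have hcard : ∀ i, ((((Nat.floorRoot k (n + h i)).divisors.filter Squarefree).card : ℕ) : ℝ) ≤
      C * ((M : ℝ) ^ (δ / (r + 1)) * t ^ (δ / (r + 1))) := by
    intro i
    have h0 : Nat.floorRoot k (n + h i) ≠ 0 := Nat.floorRoot_ne_zero.2 ⟨hk, by lia⟩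
    refine (hC _ (Nat.one_le_iff_ne_zero.2 h0)).trans ?_
    rw [← Real.mul_rpow (by positivity) (by positivity)]
    gcongr
    have h1 : Nat.floorRoot k (n + h i) ≤ n + h i :=
      (Nat.le_self_pow hk _).trans (Nat.le_of_dvd (by lia) Nat.floorRoot_pow_dvd)
    have h2 : (Nat.floorRoot k (n + h i) : ℝ) ≤ n + h i := by exact_mod_cast h1
    have h3 : (1 : ℝ) + h i ≤ M := by exact_mod_cast hM i
    have h4 : (0 : ℝ) ≤ h i := Nat.cast_nonneg _
    nlinarith
  rw [sqfTuples, Fintype.card_piFinset, Nat.cast_prod]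
  calc _ ≤ ∏ _i : Fin r, C * ((M : ℝ) ^ (δ / (r + 1)) * t ^ (δ / (r + 1))) :=
        Finset.prod_le_prod (fun _ _ => Nat.cast_nonneg _) fun i _ => hcard i
    _ = (C * (M : ℝ) ^ (δ / (r + 1))) ^ r * t ^ (δ / (r + 1) * r) := by
        rw [Finset.prod_const, Finset.card_univ, Fintype.card_fin, ← mul_assoc, mul_pow,
          ← Real.rpow_natCast (t ^ _), ← Real.rpow_mul (by positivity)]
    _ ≤ _ := by
        gcongr
        rw [div_mul_eq_mul_div, div_le_iff₀ (by positivity)]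
        nlinarith

/-- The Rankin weight `∏ d i ^ (-(1 + δ))`. -/
def rankinWeight (r : ℕ) (δ : ℝ) (d : Fin r → ℕ) : ℝ := ∏ i, (d i : ℝ) ^ (-(1 + δ))

theorem rankinWeight_nonneg (r : ℕ) (δ : ℝ) (d : Fin r → ℕ) : 0 ≤ rankinWeight r δ d :=
  Finset.prod_nonneg fun _ _ => Real.rpow_nonneg (Nat.cast_nonneg _) _

theorem summable_rankinWeight (r : ℕ) {δ : ℝ} (hδ : 0 < δ) : Summable (rankinWeight r δ) := by
  have hs : Summable fun n : ℕ => (n : ℝ) ^ (-(1 + δ)) :=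
    Real.summable_nat_rpow.2 (by linarith)
  refine summable_of_sum_le (c := (∑' n : ℕ, (n : ℝ) ^ (-(1 + δ))) ^ r)
    (rankinWeight_nonneg r δ) fun u => ?_
  calc ∑ d ∈ u, rankinWeight r δ d
      ≤ ∑ d ∈ Fintype.piFinset fun i => u.image fun d => d i, rankinWeight r δ d :=
        Finset.sum_le_sum_of_subset_of_nonneg
          (fun d hd => Fintype.mem_piFinset.2 fun i => Finset.mem_image_of_mem _ hd)
          fun d _ _ => rankinWeight_nonneg r δ d
    _ = ∏ i, ∑ n ∈ (u.image fun d => d i : Finset ℕ), (n : ℝ) ^ (-(1 + δ)) :=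
        (Finset.prod_univ_sum (fun i => u.image fun d => d i)
          fun _ (n : ℕ) => (n : ℝ) ^ (-(1 + δ))).symm
    _ ≤ ∏ _i : Fin r, ∑' n : ℕ, (n : ℝ) ^ (-(1 + δ)) :=
        Finset.prod_le_prod
          (fun _ _ => Finset.sum_nonneg fun _ _ => Real.rpow_nonneg (Nat.cast_nonneg _) _)
          fun i _ => hs.sum_le_tsum _ fun _ _ => Real.rpow_nonneg (Nat.cast_nonneg _) _
    _ = _ := by rw [Finset.prod_const, Finset.card_univ, Fintype.card_fin]

theorem one_le_prod_cast {r : ℕ} {d : Fin r → ℕ} (hd : ∀ i, 1 ≤ d i) :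
    (1 : ℝ) ≤ ∏ i, (d i : ℝ) := by
  have : 0 < ∏ i, d i := Finset.prod_pos fun i _ => hd i
  exact_mod_cast this

theorem rankinWeight_eq {r : ℕ} {δ : ℝ} (d : Fin r → ℕ) :
    rankinWeight r δ d = (∏ i, (d i : ℝ)) ^ (-(1 + δ)) :=
  Real.finsetProd_rpow _ _ (fun _ _ => Nat.cast_nonneg _) _

theorem inv_prod_pow_le_rankinWeight {k r : ℕ} {δ : ℝ} (hδk : 0 ≤ (k : ℝ) - 1 - δ)
    {d : Fin r → ℕ} {y : ℝ} (hy : 0 < y) (hyd : y ≤ ∏ i, (d i : ℝ)) :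
    ((∏ i, (d i : ℝ)) ^ k)⁻¹ ≤ y ^ (-((k : ℝ) - 1 - δ)) * rankinWeight r δ d := by
  rw [rankinWeight_eq]
  set D := ∏ i, (d i : ℝ)
  have hD : 0 < D := hy.trans_le hyd
  calc (D ^ k)⁻¹ = D ^ (-((k : ℝ) - 1 - δ)) * D ^ (-(1 + δ)) := by
        rw [← Real.rpow_add hD, ← Real.rpow_natCast, ← Real.rpow_neg hD.le]
        congr 1
        ring
    _ ≤ _ := by
        gcongr ?_ * _
        exact Real.rpow_le_rpow_of_nonpos hy hyd (by linarith)

theorem one_le_mul_rankinWeight {r : ℕ} {δ : ℝ} (hδ : 0 < δ) {d : Fin r → ℕ}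
    (hd : ∀ i, 1 ≤ d i) {Y : ℝ} (hY : ∏ i, (d i : ℝ) ≤ Y) :
    1 ≤ Y ^ (1 + δ) * rankinWeight r δ d := by
  rw [rankinWeight_eq]
  have hD := one_le_prod_cast hd
  set D := ∏ i, (d i : ℝ)
  rw [Real.rpow_neg (by linarith), ← div_eq_mul_inv, one_le_div (by positivity)]
  gcongr

/-- The tuples of positive integers with product at most `Y`. -/
def tuplesProdLE (r : ℕ) (Y : ℝ) : Finset (Fin r → ℕ) :=
  (Fintype.piFinset fun _ => Finset.Icc 1 ⌊Y⌋₊).filter fun d => ∏ i, (d i : ℝ) ≤ Y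

theorem le_prod_cast {r : ℕ} {d : Fin r → ℕ} (hd : ∀ i, 1 ≤ d i) (i : Fin r) :
    (d i : ℝ) ≤ ∏ i, (d i : ℝ) := by
  have : d i ≤ ∏ i, d i :=
    Nat.le_of_dvd (Finset.prod_pos fun i _ => hd i) (Finset.dvd_prod_of_mem d (Finset.mem_univ i))
  exact_mod_cast this

theorem mem_tuplesProdLE {r : ℕ} {Y : ℝ} {d : Fin r → ℕ} :
    d ∈ tuplesProdLE r Y ↔ (∀ i, 1 ≤ d i) ∧ ∏ i, (d i : ℝ) ≤ Y := by
  simp only [tuplesProdLE, Finset.mem_filter, Fintype.mem_piFinset, Finset.mem_Icc]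
  exact ⟨fun hd => ⟨fun i => (hd.1 i).1, hd.2⟩, fun hd => ⟨fun i => ⟨hd.1 i,
    Nat.le_floor ((le_prod_cast hd.1 i).trans hd.2)⟩, hd.2⟩⟩

theorem card_tuplesProdLE_le {r : ℕ} {δ : ℝ} (hδ : 0 < δ) {Y : ℝ} (hY : 0 ≤ Y) :
    (((tuplesProdLE r Y).card : ℕ) : ℝ) ≤ Y ^ (1 + δ) * ∑' d, rankinWeight r δ d := by
  calc (((tuplesProdLE r Y).card : ℕ) : ℝ) = ∑ _d ∈ tuplesProdLE r Y, (1 : ℝ) := by simp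
    _ ≤ ∑ d ∈ tuplesProdLE r Y, Y ^ (1 + δ) * rankinWeight r δ d :=
        Finset.sum_le_sum fun d hd =>
          one_le_mul_rankinWeight hδ (mem_tuplesProdLE.1 hd).1 (mem_tuplesProdLE.1 hd).2
    _ = Y ^ (1 + δ) * ∑ d ∈ tuplesProdLE r Y, rankinWeight r δ d := by rw [Finset.mul_sum]
    _ ≤ _ := by
        gcongr
        exact (summable_rankinWeight r hδ).sum_le_tsum _ fun d _ => rankinWeight_nonneg r δ d

theorem exists_subset_prod_mem_Icc {ι : Type*} (s : Finset ι) (x : ι → ℝ) (y M : ℝ) (hy : 1 ≤ y)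
    (hM : 1 ≤ M) (hx : ∀ i ∈ s, 1 ≤ x i ∧ x i ≤ M * y ^ 2) (hs : y ≤ ∏ i ∈ s, x i) :
    ∃ u ⊆ s, y ≤ ∏ i ∈ u, x i ∧ ∏ i ∈ u, x i ≤ M * y ^ 2 := by
  classical
  induction s using Finset.induction_on with
  | empty => exact ⟨∅, subset_rfl, hs, by simp; nlinarith⟩
  | insert i s hi ih =>
    have hxi := hx i (Finset.mem_insert_self _ _)
    rcases le_or_gt y (∏ j ∈ s, x j) with h1 | h1
    · obtain ⟨u, hu, hu'⟩ := ih (fun j hj => hx j (Finset.mem_insert_of_mem hj)) h1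
      exact ⟨u, hu.trans (Finset.subset_insert _ _), hu'⟩
    rcases le_or_gt y (x i) with h2 | h2
    · exact ⟨{i}, by simp, by simpa using h2, by simpa using hxi.2⟩
    · refine ⟨_, subset_rfl, hs, ?_⟩
      rw [Finset.prod_insert hi]
      have : x i * ∏ j ∈ s, x j ≤ y * y := by
        gcongr
        exact Finset.prod_nonneg fun j hj => by linarith [(hx j (Finset.mem_insert_of_mem hj)).1]
      nlinarith

/-- The compatibility condition under which the tuple `d` contributes to `eta`. -/
def TupleCompat (k r : ℕ) (h : Fin r → ℕ) (q a : ℕ) (d : Fin r → ℕ) : Prop :=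
  (∀ i, 1 ≤ d i) ∧
    (∀ i j, ((Nat.gcd (d i ^ k) (d j ^ k) : ℤ) ∣ (h i : ℤ) - (h j : ℤ))) ∧
    (∀ i, Nat.gcd q (d i ^ k) ∣ a + h i)

/-- The term of the series `eta` at the tuple `d`. -/
def etaTerm (k r : ℕ) (h : Fin r → ℕ) (q a : ℕ) (d : Fin r → ℕ) : ℝ :=
  if TupleCompat k r h q a d
  then (∏ i, (ArithmeticFunction.moebius (d i) : ℝ)) /
    ((Nat.lcm q (Finset.univ.lcm fun i => d i ^ k) : ℕ) : ℝ)
  else 0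

theorem eta_eq_tsum (k r : ℕ) (h : Fin r → ℕ) (q a : ℕ) :
    eta k r h q a = ∑' d, etaTerm k r h q a d := by
  unfold eta etaTerm TupleCompat
  congr!

/-- The `n ≤ t` with `n ≡ a (mod q)` and `d i ^ k ∣ n + h i` for all `i`. -/
def tupleMultiples (k r : ℕ) (h : Fin r → ℕ) (t : ℝ) (q a : ℕ) (d : Fin r → ℕ) : Finset ℕ :=
  (Finset.Icc 1 ⌊t⌋₊).filter fun n => n % q = a % q ∧ ∀ i, d i ^ k ∣ n + h i

section
variable {k r : ℕ} {h : Fin r → ℕ} {q a : ℕ} {d : Fin r → ℕ} {t : ℝ}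

theorem tupleMultiples_eq_empty (hd : ∀ i, 1 ≤ d i) (hc : ¬ TupleCompat k r h q a d) :
    tupleMultiples k r h t q a d = ∅ := by
  refine Finset.filter_eq_empty_iff.2 fun n _ hn => hc ⟨hd, fun i j => ?_, fun i => ?_⟩
  · have h1 : ((Nat.gcd (d i ^ k) (d j ^ k) : ℕ) : ℤ) ∣ ((n + h i : ℕ) : ℤ) :=
      Int.natCast_dvd_natCast.2 ((Nat.gcd_dvd_left _ _).trans (hn.2 i))
    have h2 : ((Nat.gcd (d i ^ k) (d j ^ k) : ℕ) : ℤ) ∣ ((n + h j : ℕ) : ℤ) :=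
      Int.natCast_dvd_natCast.2 ((Nat.gcd_dvd_right _ _).trans (hn.2 j))
    have := dvd_sub h1 h2
    push_cast at this
    simpa using this
  · have h1 : n + h i ≡ a + h i [MOD Nat.gcd q (d i ^ k)] :=
      (Nat.ModEq.add_right _ hn.1).of_dvd (Nat.gcd_dvd_left _ _)
    exact (h1.dvd_iff dvd_rfl).1 ((Nat.gcd_dvd_right _ _).trans (hn.2 i))

theorem lcm_tuple_pos (hq : 1 ≤ q) (hd : ∀ i, 1 ≤ d i) :
    0 < Nat.lcm q (Finset.univ.lcm fun i => d i ^ k) := by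
  refine Nat.lcm_pos hq (Nat.pos_of_ne_zero fun h0 => ?_)
  obtain ⟨i, -, hi⟩ := Finset.lcm_eq_zero_iff.1 h0
  have := hd i
  have := Nat.pow_pos (n := k) this
  lia

theorem abs_card_tupleMultiples_sub_le (hq : 1 ≤ q) (ht : 0 ≤ t)
    (hc : TupleCompat k r h q a d) :
    |(((tupleMultiples k r h t q a d).card : ℕ) : ℝ) -
      t / (Nat.lcm q (Finset.univ.lcm fun i => d i ^ k) : ℕ)| ≤ 2 := by
  have hL := lcm_tuple_pos (k := k) hq hc.1
  set L := Nat.lcm q (Finset.univ.lcm fun i => d i ^ k) with hLdef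
  obtain ⟨x, hx⟩ := exists_int_forall_dvd_sub (Finset.univ : Finset (Option (Fin r)))
    (fun o => o.elim q fun i => d i ^ k) (fun o => o.elim (a : ℤ) fun i => -(h i : ℤ)) (by
      have h1 : ∀ i, ((Nat.gcd q (d i ^ k) : ℕ) : ℤ) ∣ (a : ℤ) + h i := fun i => by
        exact_mod_cast Int.natCast_dvd_natCast.2 (hc.2.2 i)
      rintro (_ | i) - (_ | j) -
      · simp
      · simpa using h1 j
      · have := (dvd_neg (α := ℤ)).2 (h1 i)
        rw [Nat.gcd_comm] at this
        simpa [neg_add_rev, sub_eq_add_neg] using this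
      · have := (dvd_neg (α := ℤ)).2 (hc.2.1 i j)
        simpa [sub_eq_add_neg, add_comm] using this)
  have hx0 : (q : ℤ) ∣ x - a := hx none (Finset.mem_univ _)
  have hxi : ∀ i, ((d i ^ k : ℕ) : ℤ) ∣ x + h i := fun i => by
    simpa using hx (some i) (Finset.mem_univ _)
  have hLZ : (0 : ℤ) < L := by exact_mod_cast hL
  have hv : (((x % L).toNat : ℕ) : ℤ) = x % L := Int.toNat_of_nonneg (Int.emod_nonneg _ hLZ.ne')
  have hset : tupleMultiples k r h t q a d =
      (Finset.Icc 1 ⌊t⌋₊).filter fun n => n ≡ (x % L).toNat [MOD L] := by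
    refine Finset.filter_congr fun n _ => ?_
    have hmod : n ≡ (x % L).toNat [MOD L] ↔ (L : ℤ) ∣ x - n := by
      rw [← Int.natCast_modEq_iff, hv, Int.modEq_iff_dvd, Int.emod_def, sub_right_comm,
        dvd_sub_left (dvd_mul_right _ _)]
    rw [hmod, Int.natCast_dvd, hLdef, Nat.lcm_dvd_iff, Finset.lcm_dvd_iff, ← Int.natCast_dvd]
    simp only [Finset.mem_univ, true_implies, ← Int.natCast_dvd]
    refine and_congr ?_ (forall_congr' fun i => ?_)
    · change n ≡ a [MOD q] ↔ _
      rw [← Int.natCast_modEq_iff, Int.modEq_iff_dvd]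
      rw [show x - (n : ℤ) = (x - a) + (a - n) by ring, dvd_add_right hx0]
    · rw [← Int.natCast_dvd_natCast,
        show x - (n : ℤ) = (x + h i) - ((n + h i : ℕ) : ℤ) by push_cast; ring,
        dvd_sub_right (hxi i)]
  rw [hset]
  exact abs_card_modEq_sub_le L _ hL t ht

theorem inv_lcm_tuple_le (hh : Function.Injective h) (hq : 1 ≤ q) {H : ℕ} (hH1 : 1 ≤ H)
    (hH : ∀ i, h i ≤ H) (hc : TupleCompat k r h q a d) :
    ((Nat.lcm q (Finset.univ.lcm fun i => d i ^ k) : ℕ) : ℝ)⁻¹ ≤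
      ((H : ℝ) ^ r) ^ r * ((∏ i, (d i : ℝ)) ^ k)⁻¹ := by
  have hD := one_le_prod_cast hc.1
  have hL := lcm_tuple_pos (k := k) hq hc.1
  have h1 := prod_le_lcm_mul_pow Finset.univ (fun i => d i ^ k) H r hH1 (by simp)
    (fun i _ => Nat.pow_pos (hc.1 i)) fun i _ j _ hij => by
      have hne : (h i : ℤ) - h j ≠ 0 := fun h0 => hij (hh (by lia))
      have hle := Nat.le_of_dvd (Int.natAbs_pos.2 hne) (Int.natCast_dvd.1 (hc.2.1 i j))
      have := hH i
      have := hH j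
      lia
  rw [Finset.card_univ, Fintype.card_fin, Finset.prod_pow] at h1
  have h2 := h1.trans (Nat.mul_le_mul_right _ (Nat.le_of_dvd hL (Nat.dvd_lcm_right q _)))
  have h3 : (∏ i, (d i : ℝ)) ^ k ≤
      ((Nat.lcm q (Finset.univ.lcm fun i => d i ^ k) : ℕ) : ℝ) * ((H : ℝ) ^ r) ^ r := by
    exact_mod_cast h2
  have hL' : (0 : ℝ) < (Nat.lcm q (Finset.univ.lcm fun i => d i ^ k) : ℕ) := by exact_mod_cast hL
  rw [← div_eq_mul_inv, le_div_iff₀ (by positivity), inv_mul_le_iff₀ hL']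
  exact h3

theorem abs_prod_moebius_le_one (d : Fin r → ℕ) :
    |∏ i, (ArithmeticFunction.moebius (d i) : ℝ)| ≤ 1 := by
  rw [Finset.abs_prod]
  refine Finset.prod_le_one (fun _ _ => abs_nonneg _) fun i _ => ?_
  exact_mod_cast ArithmeticFunction.abs_moebius_le_one (n := d i)

theorem abs_etaTerm_le (hh : Function.Injective h) (hq : 1 ≤ q) {H : ℕ} (hH1 : 1 ≤ H)
    (hH : ∀ i, h i ≤ H) :
    |etaTerm k r h q a d| ≤ ((H : ℝ) ^ r) ^ r * ((∏ i, (d i : ℝ)) ^ k)⁻¹ := by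
  rw [etaTerm]
  split_ifs with hc
  · rw [abs_div, Nat.abs_cast, div_eq_mul_inv]
    exact (mul_le_of_le_one_left (by positivity) (abs_prod_moebius_le_one d)).trans
      (inv_lcm_tuple_le hh hq hH1 hH hc)
  · rw [abs_zero]
    positivity

theorem card_tupleMultiples_le (hh : Function.Injective h) (hq : 1 ≤ q) {H : ℕ} (hH1 : 1 ≤ H)
    (hH : ∀ i, h i ≤ H) (ht : 0 ≤ t) (hd : ∀ i, 1 ≤ d i) :
    (((tupleMultiples k r h t q a d).card : ℕ) : ℝ) ≤
      t * (((H : ℝ) ^ r) ^ r * ((∏ i, (d i : ℝ)) ^ k)⁻¹) + 2 := by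
  by_cases hc : TupleCompat k r h q a d
  · have h1 := (abs_le.1 (abs_card_tupleMultiples_sub_le hq ht hc)).2
    have h2 := mul_le_mul_of_nonneg_left (inv_lcm_tuple_le hh hq hH1 hH hc) ht
    rw [← div_eq_mul_inv] at h2
    linarith
  · rw [tupleMultiples_eq_empty hd hc]
    simp only [Finset.card_empty, Nat.cast_zero]
    positivity

theorem abs_card_mul_moebius_sub_le (hq : 1 ≤ q) (ht : 0 ≤ t) (hd : ∀ i, 1 ≤ d i) :
    |(((tupleMultiples k r h t q a d).card : ℕ) : ℝ) *
        ∏ i, (ArithmeticFunction.moebius (d i) : ℝ) - etaTerm k r h q a d * t| ≤ 2 := by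
  rw [etaTerm]
  split_ifs with hc
  · have h1 := abs_card_tupleMultiples_sub_le hq ht hc
    rw [div_mul_eq_mul_div, mul_comm _ t, mul_div_right_comm, ← sub_mul, abs_mul]
    exact (mul_le_of_le_one_right (abs_nonneg _) (abs_prod_moebius_le_one d)).trans h1
  · rw [tupleMultiples_eq_empty hd hc]
    simp

theorem abs_etaTerm_le_rankinWeight (hh : Function.Injective h) (hq : 1 ≤ q) {H : ℕ}
    (hH1 : 1 ≤ H) (hH : ∀ i, h i ≤ H) {δ : ℝ} (hδk : 0 ≤ (k : ℝ) - 1 - δ) {y : ℝ} (hy : 0 < y)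
    (hyd : (∀ i, 1 ≤ d i) → y ≤ ∏ i, (d i : ℝ)) :
    |etaTerm k r h q a d| ≤
      ((H : ℝ) ^ r) ^ r * y ^ (-((k : ℝ) - 1 - δ)) * rankinWeight r δ d := by
  by_cases hd : ∀ i, 1 ≤ d i
  · rw [mul_assoc]
    exact (abs_etaTerm_le hh hq hH1 hH).trans
      (by gcongr; exact inv_prod_pow_le_rankinWeight hδk hy (hyd hd))
  · rw [etaTerm, if_neg fun hc => hd hc.1, abs_zero]
    have := rankinWeight_nonneg r δ d
    positivity

theorem abs_eta_sub_sum_le (hh : Function.Injective h) (hq : 1 ≤ q) {H : ℕ}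
    (hH1 : 1 ≤ H) (hH : ∀ i, h i ≤ H) {δ : ℝ} (hδ : 0 < δ) (hδk : 0 ≤ (k : ℝ) - 1 - δ) {z : ℝ}
    (hz : 0 < z) :
    |eta k r h q a - ∑ d ∈ tuplesProdLE r z, etaTerm k r h q a d| ≤
      ((H : ℝ) ^ r) ^ r * z ^ (-((k : ℝ) - 1 - δ)) * ∑' d, rankinWeight r δ d := by
  have hw := summable_rankinWeight r hδ
  have hs : Summable (etaTerm k r h q a) :=
    Summable.of_norm_bounded (hw.mul_left (((H : ℝ) ^ r) ^ r * 1 ^ (-((k : ℝ) - 1 - δ)))) fun d =>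
      abs_etaTerm_le_rankinWeight hh hq hH1 hH hδk one_pos one_le_prod_cast
  rw [eta_eq_tsum, ← hs.sum_add_tsum_compl (s := tuplesProdLE r z), add_sub_cancel_left]
  have hw' := hw.subtype (↑(tuplesProdLE r z) : Set (Fin r → ℕ))ᶜ
  rw [← Real.norm_eq_abs]
  refine (tsum_of_norm_bounded (hw'.mul_left _).hasSum fun d =>
    abs_etaTerm_le_rankinWeight hh hq hH1 hH hδk hz fun hd => ?_).trans ?_
  · by_contra! hlt
    exact d.2 (mem_tuplesProdLE.2 ⟨hd, hlt.le⟩)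
  · rw [tsum_mul_left]
    gcongr
    exact hw.tsum_subtype_le _ _ (rankinWeight_nonneg r δ)

/-- If a large tuple of `k`-th powers divides the shifts of `n`, then so does a tuple whose product
lies in `[y, M y²]`. -/
theorem exists_mem_tupleMultiples_of_lt (hk : 2 ≤ k) {M : ℕ} (hM : ∀ i, 1 + h i ≤ M) {y : ℝ}
    (hM1 : 1 ≤ M) (hy : 1 ≤ y) (ht : t = y ^ (k + 1)) {n : ℕ} (hn : n ∈ Finset.Icc 1 ⌊t⌋₊)
    (hd : ∀ i, d i ^ k ∣ n + h i) (hd1 : ∀ i, 1 ≤ d i) (hyd : y ≤ ∏ i, (d i : ℝ)) :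
    ∃ e ∈ (tuplesProdLE r (M * y ^ 2)).filter fun e => y ≤ ∏ i, (e i : ℝ),
      n ∈ tupleMultiples k r h t 1 1 e := by
  have hMr : (1 : ℝ) ≤ M := by exact_mod_cast hM1
  have hn' := Finset.mem_Icc.1 hn
  have hnt : (n : ℝ) ≤ t := (Nat.le_floor_iff (by rw [ht]; positivity)).1 hn'.2
  have hn1 : (1 : ℝ) ≤ n := by exact_mod_cast hn'.1
  have hle : ∀ i, (d i : ℝ) ≤ M * y ^ 2 := fun i => by
    refine le_of_pow_le_pow_left₀ (n := k) (by lia) (by positivity) ?_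
    have h1 : (d i : ℝ) ^ k ≤ n + h i := by
      exact_mod_cast Nat.le_of_dvd (by lia) (hd i)
    have h2 : (1 : ℝ) + h i ≤ M := by exact_mod_cast hM i
    have h3 : (0 : ℝ) ≤ h i := Nat.cast_nonneg _
    calc (d i : ℝ) ^ k ≤ M * t := by nlinarith
      _ ≤ (M : ℝ) ^ k * y ^ (2 * k) := by
          rw [ht]
          gcongr
          · exact le_self_pow₀ hMr (by lia)
          lia
      _ = (M * y ^ 2) ^ k := by rw [mul_pow, pow_mul]
  obtain ⟨u, -, hu1, hu2⟩ := exists_subset_prod_mem_Icc Finset.univ (fun i => (d i : ℝ)) y M hy hMr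
    (fun i _ => ⟨by exact_mod_cast hd1 i, hle i⟩) hyd
  have hprod : ∏ i, ((if i ∈ u then d i else 1 : ℕ) : ℝ) = ∏ i ∈ u, (d i : ℝ) := by
    simp [Finset.prod_ite_mem, apply_ite]
  refine ⟨fun i => if i ∈ u then d i else 1, ?_, ?_⟩
  · rw [Finset.mem_filter, mem_tuplesProdLE, hprod]
    refine ⟨⟨fun i => ?_, hu2⟩, hu1⟩
    split_ifs
    exacts [hd1 i, le_rfl]
  · refine Finset.mem_filter.2 ⟨hn, by simp [Nat.mod_one], fun i => ?_⟩
    dsimp only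
    split_ifs
    · exact hd i
    · simp

theorem card_filter_exists_large_le (hh : Function.Injective h) (hk : 2 ≤ k) {M : ℕ}
    (hM : ∀ i, 1 + h i ≤ M) (hM1 : 1 ≤ M) {δ : ℝ} (hδ : 0 < δ) (hδk : 0 ≤ (k : ℝ) - 1 - δ)
    {y : ℝ} (hy : 1 ≤ y) (ht : t = y ^ (k + 1)) :
    ((((Finset.Icc 1 ⌊t⌋₊).filter fun n =>
      ∃ d ∈ sqfTuples k r h n, y ≤ ∏ i, (d i : ℝ)).card : ℕ) : ℝ) ≤
    (((M : ℝ) ^ r) ^ r * (t * y ^ (-((k : ℝ) - 1 - δ))) + 2 * (M * y ^ 2) ^ (1 + δ)) *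
      ∑' d, rankinWeight r δ d := by
  have ht0 : 0 ≤ t := by rw [ht]; positivity
  set B := (tuplesProdLE r (M * y ^ 2)).filter fun e => y ≤ ∏ i, (e i : ℝ) with hB
  have hsub : ((Finset.Icc 1 ⌊t⌋₊).filter fun n =>
      ∃ d ∈ sqfTuples k r h n, y ≤ ∏ i, (d i : ℝ)) ⊆ B.biUnion (tupleMultiples k r h t 1 1) := by
    intro n hn
    obtain ⟨hn, d, hd, hyd⟩ := Finset.mem_filter.1 hn
    have hd' := (mem_sqfTuples (by lia) (by have := (Finset.mem_Icc.1 hn).1; lia)).1 hd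
    exact Finset.mem_biUnion.2 (exists_mem_tupleMultiples_of_lt hk hM hM1 hy ht hn
      (fun i => (hd' i).1) (fun i => Nat.pos_of_ne_zero (hd' i).2.ne_zero) hyd)
  have hcard := (Finset.card_le_card hsub).trans Finset.card_biUnion_le
  have hZ := (summable_rankinWeight r hδ).sum_le_tsum B fun d _ => rankinWeight_nonneg r δ d
  calc _ ≤ ∑ d ∈ B, (((tupleMultiples k r h t 1 1 d).card : ℕ) : ℝ) := by exact_mod_cast hcard
    _ ≤ ∑ d ∈ B, (t * (((M : ℝ) ^ r) ^ r * (y ^ (-((k : ℝ) - 1 - δ)) * rankinWeight r δ d)) +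
          2 * ((M * y ^ 2) ^ (1 + δ) * rankinWeight r δ d)) := by
        refine Finset.sum_le_sum fun d hd => ?_
        obtain ⟨hd1, hd2⟩ := Finset.mem_filter.1 hd
        obtain ⟨hd3, hd4⟩ := mem_tuplesProdLE.1 hd1
        refine (card_tupleMultiples_le hh le_rfl hM1 (fun i => by have := hM i; lia) ht0 hd3).trans
          ?_
        have := one_le_mul_rankinWeight hδ hd3 hd4
        have := inv_prod_pow_le_rankinWeight hδk (by linarith) hd2
        gcongr
        linarith
    _ = (((M : ℝ) ^ r) ^ r * (t * y ^ (-((k : ℝ) - 1 - δ))) + 2 * (M * y ^ 2) ^ (1 + δ)) *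
          ∑ d ∈ B, rankinWeight r δ d := by
        rw [Finset.mul_sum]
        exact Finset.sum_congr rfl fun d _ => by ring
    _ ≤ _ := by gcongr

theorem countR_eq_sum (k r : ℕ) (h : Fin r → ℕ) (t : ℝ) (q a : ℕ) :
    (countR k r h t q a : ℝ) =
      ∑ n ∈ (Finset.Icc 1 ⌊t⌋₊).filter fun n => n % q = a % q,
        ∑ d ∈ sqfTuples k r h n, ∏ i, (ArithmeticFunction.moebius (d i) : ℝ) := by
  simp_rw [sum_sqfTuples_moebius]
  rw [countR, Finset.sum_boole, Finset.filter_filter]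
  simp_rw [and_comm]

theorem sum_sum_sqfTuples_small (hk : k ≠ 0) (z : ℝ) :
    ∑ n ∈ (Finset.Icc 1 ⌊t⌋₊).filter fun n => n % q = a % q,
      ∑ d ∈ sqfTuples k r h n with ∏ i, (d i : ℝ) ≤ z,
        ∏ i, (ArithmeticFunction.moebius (d i) : ℝ) =
    ∑ d ∈ tuplesProdLE r z, (((tupleMultiples k r h t q a d).card : ℕ) : ℝ) *
        ∏ i, (ArithmeticFunction.moebius (d i) : ℝ) := by
  have h1 : ∀ n ∈ (Finset.Icc 1 ⌊t⌋₊).filter fun n => n % q = a % q,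
      ∑ d ∈ sqfTuples k r h n with ∏ i, (d i : ℝ) ≤ z,
        ∏ i, (ArithmeticFunction.moebius (d i) : ℝ) =
      ∑ d ∈ tuplesProdLE r z, if ∀ i, d i ^ k ∣ n + h i then
        ∏ i, (ArithmeticFunction.moebius (d i) : ℝ) else 0 := by
    intro n hn
    have hn0 : n ≠ 0 := by
      have := (Finset.mem_Icc.1 (Finset.mem_filter.1 hn).1).1
      lia
    rw [← Finset.sum_filter]
    refine Finset.sum_subset (fun d hd => ?_) fun d hd hd' => ?_
    · obtain ⟨hd1, hd2⟩ := Finset.mem_filter.1 hd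
      rw [mem_sqfTuples hk hn0] at hd1
      exact Finset.mem_filter.2 ⟨mem_tuplesProdLE.2
        ⟨fun i => Nat.pos_of_ne_zero (hd1 i).2.ne_zero, hd2⟩, fun i => (hd1 i).1⟩
    · obtain ⟨hd1, hd2⟩ := Finset.mem_filter.1 hd
      by_contra hne
      refine hd' (Finset.mem_filter.2 ⟨(mem_sqfTuples hk hn0).2 fun i => ⟨hd2 i, ?_⟩,
        (mem_tuplesProdLE.1 hd1).2⟩)
      have := Finset.prod_ne_zero_iff.1 hne i (Finset.mem_univ i)
      exact ArithmeticFunction.moebius_ne_zero_iff_squarefree.1 (by exact_mod_cast this)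
  rw [Finset.sum_congr rfl h1, Finset.sum_comm]
  refine Finset.sum_congr rfl fun d _ => ?_
  rw [← Finset.sum_filter, Finset.filter_filter, Finset.sum_const, nsmul_eq_mul]
  rfl

theorem abs_sum_sum_sqfTuples_large_le {y z T : ℝ} (hyz : y ≤ z)
    (hT : ∀ n ∈ Finset.Icc 1 ⌊t⌋₊, (((sqfTuples k r h n).card : ℕ) : ℝ) ≤ T) :
    |∑ n ∈ (Finset.Icc 1 ⌊t⌋₊).filter fun n => n % q = a % q,
      ∑ d ∈ sqfTuples k r h n with ¬ ∏ i, (d i : ℝ) ≤ z,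
        ∏ i, (ArithmeticFunction.moebius (d i) : ℝ)| ≤
    ((((Finset.Icc 1 ⌊t⌋₊).filter fun n =>
      ∃ d ∈ sqfTuples k r h n, y ≤ ∏ i, (d i : ℝ)).card : ℕ) : ℝ) * T := by
  rw [← nsmul_eq_mul, ← Finset.sum_const, Finset.sum_filter (p := fun n =>
    ∃ d ∈ sqfTuples k r h n, y ≤ ∏ i, (d i : ℝ))]
  have hpt : ∀ n ∈ Finset.Icc 1 ⌊t⌋₊, |∑ d ∈ sqfTuples k r h n with ¬ ∏ i, (d i : ℝ) ≤ z,
      ∏ i, (ArithmeticFunction.moebius (d i) : ℝ)| ≤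
      if ∃ d ∈ sqfTuples k r h n, y ≤ ∏ i, (d i : ℝ) then T else 0 := by
    intro n hn
    split_ifs with hbad
    · calc _ ≤ ∑ d ∈ sqfTuples k r h n with ¬ ∏ i, (d i : ℝ) ≤ z, (1 : ℝ) :=
            (Finset.abs_sum_le_sum_abs _ _).trans
              (Finset.sum_le_sum fun d _ => abs_prod_moebius_le_one d)
        _ ≤ ∑ d ∈ sqfTuples k r h n, (1 : ℝ) :=
            Finset.sum_le_sum_of_subset_of_nonneg (Finset.filter_subset _ _)
              fun _ _ _ => zero_le_one
        _ ≤ T := by simpa using hT n hn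
    · rw [Finset.filter_eq_empty_iff.2, Finset.sum_empty, abs_zero]
      intro d hd hlt
      exact hbad ⟨d, hd, hyz.trans (not_le.1 hlt).le⟩
  refine (Finset.abs_sum_le_sum_abs _ _).trans
    ((Finset.sum_le_sum_of_subset_of_nonneg (Finset.filter_subset _ _)
      fun _ _ _ => abs_nonneg _).trans (Finset.sum_le_sum hpt))

end

/-- `#{n ≤ t : n ∈ ℛ, n ≡ a (mod q)} = η(q,a)·t + O(t^{2/(k+1)+ε})`,
uniformly in `q` and `a`. -/
theorem stmt_4 (k r : ℕ) (hk : 2 ≤ k) (hr : 1 ≤ r) (h : Fin r → ℕ) (hh : StrictMono h)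
    (ε : ℝ) (hε : 0 < ε) :
    ∃ C : ℝ, ∀ t : ℝ, 1 ≤ t → ∀ q a : ℕ, 1 ≤ q → 1 ≤ a →
      |(countR k r h t q a : ℝ) - eta k r h q a * t|
        ≤ C * t ^ (2/((k:ℝ)+1) + ε) := by
  have hk0 : k ≠ 0 := by lia
  have hkr : (2 : ℝ) ≤ k := by exact_mod_cast hk
  obtain ⟨δ, hδ, hδ1, hδε⟩ : ∃ δ : ℝ, 0 < δ ∧ δ ≤ 1 ∧ 2 * δ ≤ ε :=
    ⟨min 1 (ε / 2), lt_min one_pos (half_pos hε), min_le_left _ _, by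
      linarith [min_le_right 1 (ε / 2)]⟩
  have hδk : 0 ≤ (k : ℝ) - 1 - δ := by linarith
  obtain ⟨M, hM1, hM⟩ : ∃ M : ℕ, 1 ≤ M ∧ ∀ i, 1 + h i ≤ M :=
    ⟨1 + ∑ i, h i, by lia, fun i => by
      have := Finset.single_le_sum (f := h) (fun _ _ => Nat.zero_le _) (Finset.mem_univ i)
      lia⟩
  obtain ⟨C, hC0, hC⟩ := exists_card_sqfTuples_le k r hk0 h M hM1 hM δ hδ
  set Z := ∑' d, rankinWeight r δ d with hZ
  have hZ0 : 0 ≤ Z := tsum_nonneg (rankinWeight_nonneg r δ)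
  set K : ℝ := ((M : ℝ) ^ r) ^ r with hK
  have hK0 : 0 ≤ K := by positivity
  refine ⟨2 * Z + K * Z + (K + 2 * (M : ℝ) ^ (1 + δ)) * Z * C, fun t ht q a hq _ => ?_⟩
  have ht0 : 0 < t := by linarith
  set y : ℝ := t ^ ((k : ℝ) + 1)⁻¹ with hy_def
  have hy : 1 ≤ y := Real.one_le_rpow ht (by positivity)
  have hy0 : 0 < y := by linarith
  have hty : t = y ^ (k + 1) := by
    rw [hy_def, ← Real.rpow_natCast, ← Real.rpow_mul ht0.le]
    push_cast
    rw [inv_mul_cancel₀ (by positivity), Real.rpow_one]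
  have hyz : y ≤ y ^ 2 := le_self_pow₀ hy two_ne_zero
  set W : ℝ := y ^ (2 * (1 + δ)) with hW
  have hW0 : 0 ≤ W := by positivity
  have hsq : (y ^ 2) ^ (1 + δ) = W := by
    rw [hW, ← Real.rpow_natCast, ← Real.rpow_mul hy0.le]
    norm_num
  have htail : t * y ^ (-((k : ℝ) - 1 - δ)) ≤ W := by
    rw [hW, hty, ← Real.rpow_natCast, ← Real.rpow_add hy0]
    refine Real.rpow_le_rpow_of_exponent_le hy ?_
    push_cast
    linarith
  have hWt : t ^ δ * W ≤ t ^ (2 / ((k : ℝ) + 1) + ε) := by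
    rw [hW, hy_def, ← Real.rpow_mul ht0.le, ← Real.rpow_add ht0]
    refine Real.rpow_le_rpow_of_exponent_le ht ?_
    have h1 : ((k : ℝ) + 1)⁻¹ ≤ 2⁻¹ := by gcongr; linarith
    rw [div_eq_mul_inv]
    nlinarith
  have htδ : 1 ≤ t ^ δ := Real.one_le_rpow ht hδ.le
  have hsplit : (countR k r h t q a : ℝ) =
      ∑ d ∈ tuplesProdLE r (y ^ 2), (((tupleMultiples k r h t q a d).card : ℕ) : ℝ) *
        ∏ i, (ArithmeticFunction.moebius (d i) : ℝ) +
      ∑ n ∈ (Finset.Icc 1 ⌊t⌋₊).filter fun n => n % q = a % q,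
        ∑ d ∈ sqfTuples k r h n with ¬ ∏ i, (d i : ℝ) ≤ y ^ 2,
          ∏ i, (ArithmeticFunction.moebius (d i) : ℝ) := by
    rw [countR_eq_sum, ← sum_sum_sqfTuples_small hk0, ← Finset.sum_add_distrib]
    exact Finset.sum_congr rfl fun n _ => (Finset.sum_filter_add_sum_filter_not _ _ _).symm
  have hmain : |∑ d ∈ tuplesProdLE r (y ^ 2), (((tupleMultiples k r h t q a d).card : ℕ) : ℝ) *
        ∏ i, (ArithmeticFunction.moebius (d i) : ℝ) -
      (∑ d ∈ tuplesProdLE r (y ^ 2), etaTerm k r h q a d) * t| ≤ 2 * Z * W := by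
    rw [Finset.sum_mul, ← Finset.sum_sub_distrib]
    calc _ ≤ ∑ _d ∈ tuplesProdLE r (y ^ 2), (2 : ℝ) :=
          (Finset.abs_sum_le_sum_abs _ _).trans (Finset.sum_le_sum fun d hd =>
            abs_card_mul_moebius_sub_le hq ht0.le (mem_tuplesProdLE.1 hd).1)
      _ = 2 * (((tuplesProdLE r (y ^ 2)).card : ℕ) : ℝ) := by
          rw [Finset.sum_const, nsmul_eq_mul, mul_comm]
      _ ≤ 2 * ((y ^ 2) ^ (1 + δ) * Z) := by
          gcongr
          exact card_tuplesProdLE_le hδ (by positivity)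
      _ = 2 * Z * W := by rw [hsq]; ring
  have heta : |(eta k r h q a - ∑ d ∈ tuplesProdLE r (y ^ 2), etaTerm k r h q a d) * t| ≤
      K * Z * W := by
    rw [abs_mul, abs_of_pos ht0]
    calc _ ≤ K * (y ^ 2) ^ (-((k : ℝ) - 1 - δ)) * Z * t := by
          gcongr
          exact abs_eta_sub_sum_le hh.injective hq hM1 (fun i => by have := hM i; lia) hδ hδk
            (by positivity)
      _ ≤ K * y ^ (-((k : ℝ) - 1 - δ)) * Z * t := by
          gcongr ?_ * _ * _
          gcongr K * ?_
          exact Real.rpow_le_rpow_of_nonpos hy0 hyz (by linarith)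
      _ = K * Z * (t * y ^ (-((k : ℝ) - 1 - δ))) := by ring
      _ ≤ K * Z * W := by gcongr
  have hlarge : |∑ n ∈ (Finset.Icc 1 ⌊t⌋₊).filter fun n => n % q = a % q,
        ∑ d ∈ sqfTuples k r h n with ¬ ∏ i, (d i : ℝ) ≤ y ^ 2,
          ∏ i, (ArithmeticFunction.moebius (d i) : ℝ)| ≤
      (K + 2 * (M : ℝ) ^ (1 + δ)) * Z * C * (t ^ δ * W) := by
    refine (abs_sum_sum_sqfTuples_large_le hyz (T := C * t ^ δ) fun n hn => ?_).trans ?_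
    · have hn' := Finset.mem_Icc.1 hn
      exact hC t ht n hn'.1 ((Nat.le_floor_iff ht0.le).1 hn'.2)
    · calc _ ≤ (K * (t * y ^ (-((k : ℝ) - 1 - δ))) + 2 * (M * y ^ 2) ^ (1 + δ)) * Z *
            (C * t ^ δ) := by
            gcongr
            exact card_filter_exists_large_le hh.injective hk hM hM1 hδ hδk hy hty
        _ ≤ (K * W + 2 * ((M : ℝ) ^ (1 + δ) * W)) * Z * (C * t ^ δ) := by
            rw [Real.mul_rpow (by positivity) (by positivity), hsq]
            gcongr
        _ = _ := by ring
  have hWle : W ≤ t ^ δ * W := le_mul_of_one_le_left hW0 htδ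
  calc |(countR k r h t q a : ℝ) - eta k r h q a * t|
      ≤ 2 * Z * W + K * Z * W + (K + 2 * (M : ℝ) ^ (1 + δ)) * Z * C * (t ^ δ * W) := by
        rw [hsplit]
        rw [abs_le] at hmain heta hlarge ⊢
        constructor <;> linarith [hmain.1, hmain.2, heta.1, heta.2, hlarge.1, hlarge.2]
    _ ≤ 2 * Z * (t ^ δ * W) + K * Z * (t ^ δ * W) +
          (K + 2 * (M : ℝ) ^ (1 + δ)) * Z * C * (t ^ δ * W) := by gcongr
    _ = (2 * Z + K * Z + (K + 2 * (M : ℝ) ^ (1 + δ)) * Z * C) * (t ^ δ * W) := by ring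
    _ ≤ _ := by gcongr
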